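/- Set b_j = Σ_{i=1}^{c} a_{i,μ_j} for j = 1, …, r, and assume b_1, …, b_r are pairwise distinct. For every n ≥ μ_r − 1, the following identity holds in ℚ: deg I_n = Σ_{i=1}^{r} b_i^{n−μ_r+r} / ∏_{j≠i} (b_i − b_j). -/

import Mathlib

open MvPolynomial

noncomputable section

/-- The monomial `x^a = ∏_{i} ∏_{1 ≤ j ≤ μ_r} x_{i,j}^{a_{i,j}}` in
`K[X] = K[x_{i,j} : 1 ≤ i ≤ c, j ≥ 1]` (column indices in `ℕ`, only indices `≥ 1` occur). -/
def orbMonC (K : Type*) [Field K] (c r : ℕ) (μ : ℕ → ℕ) (a : Fin c → ℕ → ℕ) :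
    MvPolynomial (Fin c × ℕ) K :=
  ∏ i : Fin c, ∏ j ∈ Finset.Icc 1 (μ (r - 1)),
    (X (i, j) : MvPolynomial (Fin c × ℕ) K) ^ a i j

/-- The ideal generated by the `Inc`-orbit of a polynomial, the monoid `Inc` of strictly
increasing maps acting by `π · x_{i,j} = x_{i,π(j)}`. -/
def orbitIdealC (K : Type*) [Field K] {c : ℕ} (m : MvPolynomial (Fin c × ℕ) K) :
    Ideal (MvPolynomial (Fin c × ℕ) K) :=
  Ideal.span {q | ∃ π : ℕ → ℕ, StrictMono π ∧ q = rename (fun p => (p.1, π p.2)) m}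

/-- Index type for the columns `1, …, n` of `K[X_n]`. -/
abbrev ColIdx (n : ℕ) := {j : ℕ // j ∈ Finset.Icc 1 n}

/-- The inclusion `K[X_n] → K[X]`. -/
def toBigC (K : Type*) [Field K] (c n : ℕ) :
    MvPolynomial (Fin c × ColIdx n) K →ₐ[K] MvPolynomial (Fin c × ℕ) K :=
  rename fun p => (p.1, p.2.1)

/-- `I_n = I ∩ K[X_n]`, realized as an ideal of `K[X_n]` (this is legitimate because
`toBigC` is injective). -/
def restrC (K : Type*) [Field K] {c : ℕ} (I : Ideal (MvPolynomial (Fin c × ℕ) K)) (n : ℕ) :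
    Ideal (MvPolynomial (Fin c × ColIdx n) K) :=
  Ideal.comap (toBigC K c n) I

/-- The inclusion `K[X_m] → K[X_n]` for `m ≤ n`. -/
def inclC (K : Type*) [Field K] (c : ℕ) {m n : ℕ} (h : m ≤ n) :
    MvPolynomial (Fin c × ColIdx m) K →ₐ[K] MvPolynomial (Fin c × ColIdx n) K :=
  rename fun p => (p.1, ⟨p.2.1, Finset.Icc_subset_Icc le_rfl h p.2.2⟩)

/-- The dimension of the degree `j` component of `K[X_n]/I`, for a homogeneous ideal `I`:
the `K`-dimension of (homogeneous polynomials of degree `j`) modulo (those lying in `I`). -/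
def hilbF (K : Type*) [Field K] {σ : Type*} (I : Ideal (MvPolynomial σ K)) (j : ℕ) : ℕ :=
  Module.finrank K
    (↥(homogeneousSubmodule σ K j) ⧸
      (Submodule.comap (homogeneousSubmodule σ K j).subtype (Submodule.restrictScalars K I)))

/-- The Hilbert series of `K[X_n]/I` as a power series in `ℤ[[t]]`. -/
def hseries (K : Type*) [Field K] {σ : Type*} (I : Ideal (MvPolynomial σ K)) :
    PowerSeries ℤ :=
  PowerSeries.mk fun j => (hilbF K I j : ℤ)

end

/-- The generating function counting the elements of `S` by weight. -/
noncomputable def weightSeries {α : Type*} (wt : α → ℕ) (S : Set α) : PowerSeries ℤ :=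
  PowerSeries.mk fun d => ({x ∈ S | wt x = d}.ncard : ℤ)

/-- Every weight is attained by finitely many elements of `S`. -/
def FiniteWeights {α : Type*} (wt : α → ℕ) (S : Set α) : Prop :=
  ∀ d, {x ∈ S | wt x = d}.Finite

section WeightSeries

variable {α β : Type*} {wt : α → ℕ} {wt' : β → ℕ} {S T : Set α}

lemma FiniteWeights.union (hS : FiniteWeights wt S) (hT : FiniteWeights wt T) :
    FiniteWeights wt (S ∪ T) := fun d =>
  ((hS d).union (hT d)).subset fun _ hx => hx.1.imp (fun h => ⟨h, hx.2⟩) fun h => ⟨h, hx.2⟩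

lemma FiniteWeights.image (hS : FiniteWeights wt S) {f : α → β}
    (hf : ∀ x, wt' (f x) = wt x) : FiniteWeights wt' (f '' S) := by
  refine fun d => ((hS d).image f).subset ?_
  rintro _ ⟨⟨x, hx, rfl⟩, h⟩
  exact ⟨x, ⟨hx, (hf x).symm.trans h⟩, rfl⟩

lemma FiniteWeights.prod (hS : FiniteWeights wt S) {U : Set β} (hU : FiniteWeights wt' U) :
    FiniteWeights (fun p : α × β => wt p.1 + wt' p.2) (S ×ˢ U) := by
  intro d
  refine Set.Finite.subset (Set.Finite.biUnion (Finset.finite_toSet (Finset.HasAntidiagonal.antidiagonal d))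
    fun q _ => (hS q.1).prod (hU q.2)) ?_
  rintro ⟨x, y⟩ ⟨⟨hx, hy⟩, h⟩
  simp only [Set.mem_iUnion]
  exact ⟨(wt x, wt' y), by simpa using h, ⟨hx, rfl⟩, ⟨hy, rfl⟩⟩

lemma weightSeries_union (hS : FiniteWeights wt S) (hT : FiniteWeights wt T)
    (hST : Disjoint S T) :
    weightSeries wt (S ∪ T) = weightSeries wt S + weightSeries wt T := by
  ext d
  simp only [weightSeries, PowerSeries.coeff_mk, map_add]
  rw [← Nat.cast_add, ← Set.ncard_union_eq _ (hS d) (hT d)]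
  · congr 2
    ext x
    simp only [Set.mem_ofPred_eq, Set.mem_union]
    tauto
  · exact hST.mono (fun _ h => h.1) fun _ h => h.1

lemma weightSeries_image_add {f : α → β} (hf : Function.Injective f) {k : ℕ}
    (hwt : ∀ x, wt' (f x) = wt x + k) :
    weightSeries wt' (f '' S) = PowerSeries.X ^ k * weightSeries wt S := by
  ext d
  rw [PowerSeries.coeff_X_pow_mul']
  simp only [weightSeries, PowerSeries.coeff_mk]
  split_ifs with h
  · rw [← Set.ncard_image_of_injective _ hf]
    congr 2
    ext y
    constructor
    · rintro ⟨⟨x, hx, rfl⟩, hd⟩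
      exact ⟨x, ⟨hx, by have := hwt x; omega⟩, rfl⟩
    · rintro ⟨x, ⟨hx, hd⟩, rfl⟩
      exact ⟨⟨x, hx, rfl⟩, by have := hwt x; omega⟩
  · rw [Nat.cast_eq_zero]
    convert Set.ncard_empty β
    ext y
    simp only [Set.mem_ofPred_eq, Set.mem_empty_iff_false, iff_false]
    rintro ⟨⟨x, hx, rfl⟩, hd⟩
    have := hwt x
    omega

lemma weightSeries_image {f : α → β} (hf : Function.Injective f)
    (hwt : ∀ x, wt' (f x) = wt x) : weightSeries wt' (f '' S) = weightSeries wt S := by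
  simpa using weightSeries_image_add (S := S) hf (k := 0) hwt

lemma weightSeries_prod (hS : FiniteWeights wt S) {U : Set β} (hU : FiniteWeights wt' U) :
    weightSeries (fun p : α × β => wt p.1 + wt' p.2) (S ×ˢ U) =
      weightSeries wt S * weightSeries wt' U := by
  classical
  ext d
  rw [PowerSeries.coeff_mul]
  simp only [weightSeries, PowerSeries.coeff_mk]
  have key : {p ∈ S ×ˢ U | wt p.1 + wt' p.2 = d} =
      (((Finset.HasAntidiagonal.antidiagonal d).biUnion fun q =>
        (hS q.1).toFinset ×ˢ (hU q.2).toFinset : Finset (α × β)) : Set (α × β)) := by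
    ext ⟨x, y⟩
    simp only [Set.mem_ofPred_eq, Set.mem_prod, Finset.coe_biUnion, Set.mem_iUnion,
      Finset.mem_coe, Finset.mem_product, Set.Finite.mem_toFinset, Finset.HasAntidiagonal.mem_antidiagonal]
    constructor
    · rintro ⟨⟨hx, hy⟩, h⟩
      exact ⟨(wt x, wt' y), h, ⟨hx, rfl⟩, ⟨hy, rfl⟩⟩
    · rintro ⟨q, hq, ⟨hx, hx'⟩, ⟨hy, hy'⟩⟩
      exact ⟨⟨hx, hy⟩, by rw [hx', hy', hq]⟩
  rw [key, Set.ncard_coe_finset, Finset.card_biUnion]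
  · rw [Nat.cast_sum]
    refine Finset.sum_congr rfl fun q _ => ?_
    rw [Finset.card_product, Nat.cast_mul, Set.ncard_eq_toFinset_card _ (hS q.1),
      Set.ncard_eq_toFinset_card _ (hU q.2)]
  · intro q _ q' _ hne
    rw [Function.onFun, Finset.disjoint_left]
    rintro ⟨x, y⟩ h h'
    simp only [Finset.mem_product, Set.Finite.mem_toFinset, Set.mem_ofPred_eq] at h h'
    exact hne (Prod.ext (h.1.2.symm.trans h'.1.2) (h.2.2.symm.trans h'.2.2))

end WeightSeries

lemma finiteWeights_column {c : ℕ} (S : Set (Fin c → ℕ)) :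
    FiniteWeights (fun v => ∑ i, v i) S := by
  refine fun d => (Set.finite_Iic (fun _ : Fin c => d)).subset ?_
  rintro v ⟨-, hv⟩ i
  exact (Finset.single_le_sum (fun _ _ => Nat.zero_le _) (Finset.mem_univ i)).trans hv.le

lemma weightSeries_nat : weightSeries (fun k : ℕ => k) Set.univ * (1 - PowerSeries.X) = 1 := by
  convert PowerSeries.mk_one_mul_one_sub_eq_one ℤ
  ext d
  simp [weightSeries]

lemma weightSeries_column (c : ℕ) :
    (1 - PowerSeries.X) ^ c * weightSeries (fun v : Fin c → ℕ => ∑ i, v i) Set.univ = 1 := by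
  induction c with
  | zero =>
    ext d
    simp only [pow_zero, one_mul, weightSeries, PowerSeries.coeff_mk, PowerSeries.coeff_one,
      Finset.univ_eq_empty, Finset.sum_empty, Set.mem_univ, true_and]
    split_ifs with h
    · subst h
      simp
    · simp [Ne.symm h]
  | succ c ih =>
    have h : (Set.univ : Set (Fin (c + 1) → ℕ)) =
        (fun p : ℕ × (Fin c → ℕ) => (Fin.cons p.1 p.2 : Fin (c + 1) → ℕ)) ''
          (Set.univ ×ˢ Set.univ) := by
      symm
      rw [Set.univ_prod_univ, Set.image_univ, Set.range_eq_univ]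
      exact fun v => ⟨(v 0, Fin.tail v), Fin.cons_self_tail v⟩
    have hnat : FiniteWeights (fun k : ℕ => k) Set.univ := fun d =>
      (Set.finite_singleton d).subset fun _ hx => hx.2
    rw [h, weightSeries_image (wt := fun p : ℕ × (Fin c → ℕ) => p.1 + ∑ i, p.2 i),
      weightSeries_prod (wt := fun k : ℕ => k) (wt' := fun v : Fin c → ℕ => ∑ i, v i)
        hnat (finiteWeights_column _)]
    · linear_combination ((1 - PowerSeries.X) ^ c *
        weightSeries (fun v : Fin c → ℕ => ∑ i, v i) Set.univ) * weightSeries_nat + ih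
    · rintro ⟨x, v⟩ ⟨y, w⟩ hp
      obtain ⟨h1, h2⟩ := Fin.cons_injective2 hp
      exact Prod.ext h1 h2
    · intro p
      simp [Fin.sum_univ_succ]

lemma weightSeries_column_ge {c : ℕ} (A : Fin c → ℕ) :
    weightSeries (fun v : Fin c → ℕ => ∑ i, v i) {v | A ≤ v} =
      PowerSeries.X ^ (∑ i, A i) * weightSeries (fun v : Fin c → ℕ => ∑ i, v i) Set.univ := by
  rw [← weightSeries_image_add (wt' := fun v : Fin c → ℕ => ∑ i, v i) (f := fun v => v + A)
    (add_left_injective A) (by simp [Finset.sum_add_distrib])]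
  congr 1
  ext v
  simp only [Set.mem_ofPred_eq, Set.image_univ, Set.mem_range]
  exact ⟨fun h => ⟨v - A, tsub_add_cancel_of_le h⟩, by rintro ⟨w, rfl⟩; exact le_add_self⟩

lemma weightSeries_column_not_ge {c : ℕ} (A : Fin c → ℕ) :
    weightSeries (fun v : Fin c → ℕ => ∑ i, v i) {v | ¬ A ≤ v} =
      (1 - PowerSeries.X ^ (∑ i, A i)) *
        weightSeries (fun v : Fin c → ℕ => ∑ i, v i) Set.univ := by
  have h := weightSeries_union (finiteWeights_column {v | A ≤ v})
    (finiteWeights_column {v | ¬ A ≤ v}) (Set.disjoint_left.2 fun _ h h' => h' h)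
  rw [weightSeries_column_ge, show {v | A ≤ v} ∪ {v | ¬ A ≤ v} = Set.univ from
    Set.eq_univ_of_forall fun v => em _] at h
  linear_combination -h

/-- The total degree of a monomial given as a list of exponent columns. -/
def wordDegree {c : ℕ} (w : List (Fin c → ℕ)) : ℕ := (w.map fun v => ∑ i, v i).sum

/-- The words of `n` columns that do not contain a pattern `L` as a dominated subword. -/
def avoidingWords {c : ℕ} (L : List (Fin c → ℕ)) (n : ℕ) : Set (List (Fin c → ℕ)) :=
  {w | w.length = n ∧ ¬ List.SublistForall₂ (· ≤ ·) L w}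

lemma List.sublistForall₂_cons_cons_iff {α β : Type*} {R : α → β → Prop} {x : α} {y : β}
    {l : List α} {l' : List β} (h : R x y) :
    SublistForall₂ R (x :: l) (y :: l') ↔ SublistForall₂ R l l' := by
  refine ⟨fun H => ?_, SublistForall₂.cons h⟩
  have tail : ∀ {m : List α} {m' : List β}, SublistForall₂ R m m' →
      ∀ {x l}, m = x :: l → SublistForall₂ R l m' := by
    intro m m' H
    induction H with
    | nil => simp
    | cons _ H _ =>
      rintro x l h
      obtain ⟨-, rfl⟩ := List.cons.inj h
      exact .cons_right H
    | cons_right _ ih => exact fun h => .cons_right (ih h)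
  cases H with
  | cons _ H => exact H
  | cons_right H => exact tail H rfl

lemma List.sublistForall₂_cons_cons_iff_of_not {α β : Type*} {R : α → β → Prop} {x : α} {y : β}
    {l : List α} {l' : List β} (h : ¬ R x y) :
    SublistForall₂ R (x :: l) (y :: l') ↔ SublistForall₂ R (x :: l) l' := by
  refine ⟨fun H => ?_, SublistForall₂.cons_right⟩
  cases H with
  | cons h' _ => exact absurd h' h
  | cons_right H => exact H

lemma weightSeries_empty {α : Type*} (wt : α → ℕ) : weightSeries wt ∅ = 0 := by
  ext d
  simp [weightSeries]

lemma avoidingWords_nil {c : ℕ} (n : ℕ) : avoidingWords ([] : List (Fin c → ℕ)) n = ∅ :=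
  Set.eq_empty_of_forall_notMem fun _ h => h.2 .nil

lemma avoidingWords_cons_zero {c : ℕ} (A : Fin c → ℕ) (L : List (Fin c → ℕ)) :
    avoidingWords (A :: L) 0 = {[]} := by
  ext w
  simp only [avoidingWords, Set.mem_ofPred_eq, List.length_eq_zero_iff, Set.mem_singleton_iff,
    and_iff_left_iff_imp]
  rintro rfl h
  cases h

lemma avoidingWords_cons_succ {c : ℕ} (A : Fin c → ℕ) (L : List (Fin c → ℕ)) (n : ℕ) :
    avoidingWords (A :: L) (n + 1) =
      (fun p : (Fin c → ℕ) × List (Fin c → ℕ) => p.1 :: p.2) ''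
        ({v | A ≤ v} ×ˢ avoidingWords L n ∪ {v | ¬ A ≤ v} ×ˢ avoidingWords (A :: L) n) := by
  ext w
  constructor
  · rintro ⟨hlen, hw⟩
    obtain ⟨v, w, rfl⟩ := List.exists_cons_of_length_eq_add_one hlen
    refine ⟨(v, w), ?_, rfl⟩
    have hlen' : w.length = n := by simpa using hlen
    by_cases h : A ≤ v
    · exact .inl ⟨h, hlen', by rwa [List.sublistForall₂_cons_cons_iff h] at hw⟩
    · exact .inr ⟨h, hlen', by rwa [List.sublistForall₂_cons_cons_iff_of_not h] at hw⟩
  · rintro ⟨⟨v, w⟩, ⟨h, hlen, hw⟩ | ⟨h, hlen, hw⟩, rfl⟩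
    · exact ⟨by simpa using hlen, (List.sublistForall₂_cons_cons_iff (R := (· ≤ ·)) h).not.2 hw⟩
    · exact ⟨by simpa using hlen, (List.sublistForall₂_cons_cons_iff_of_not h).not.2 hw⟩

lemma finiteWeights_avoidingWords {c : ℕ} (L : List (Fin c → ℕ)) (n : ℕ) :
    FiniteWeights wordDegree (avoidingWords L n) := by
  induction n generalizing L with
  | zero =>
    refine fun d => (Set.finite_singleton []).subset ?_
    rintro w ⟨⟨hw, -⟩, -⟩
    exact List.length_eq_zero_iff.1 hw
  | succ n ih =>
    cases L with
    | nil => rw [avoidingWords_nil]; exact fun d => by simp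
    | cons A L =>
      rw [avoidingWords_cons_succ]
      refine FiniteWeights.image
        (wt := fun p : (Fin c → ℕ) × List (Fin c → ℕ) => (∑ i, p.1 i) + wordDegree p.2) ?_
        fun p => by simp [wordDegree]
      exact ((finiteWeights_column _).prod (ih L)).union
        ((finiteWeights_column _).prod (ih (A :: L)))

lemma weightSeries_avoidingWords_cons_succ {c : ℕ} (A : Fin c → ℕ) (L : List (Fin c → ℕ))
    (n : ℕ) :
    (1 - PowerSeries.X) ^ c * weightSeries wordDegree (avoidingWords (A :: L) (n + 1)) =
      PowerSeries.X ^ (∑ i, A i) * weightSeries wordDegree (avoidingWords L n) +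
        (1 - PowerSeries.X ^ (∑ i, A i)) *
          weightSeries wordDegree (avoidingWords (A :: L) n) := by
  have h₁ := finiteWeights_avoidingWords L n
  have h₂ := finiteWeights_avoidingWords (A :: L) n
  rw [avoidingWords_cons_succ, weightSeries_image
    (wt := fun p : (Fin c → ℕ) × List (Fin c → ℕ) => (∑ i, p.1 i) + wordDegree p.2),
    weightSeries_union ((finiteWeights_column _).prod h₁) ((finiteWeights_column _).prod h₂),
    weightSeries_prod (wt := fun v : Fin c → ℕ => ∑ i, v i) (finiteWeights_column _) h₁,
    weightSeries_prod (wt := fun v : Fin c → ℕ => ∑ i, v i) (finiteWeights_column _) h₂,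
    weightSeries_column_ge, weightSeries_column_not_ge]
  · linear_combination (PowerSeries.X ^ (∑ i, A i) * weightSeries wordDegree (avoidingWords L n) +
      (1 - PowerSeries.X ^ (∑ i, A i)) *
        weightSeries wordDegree (avoidingWords (A :: L) n)) * weightSeries_column c
  · rw [Set.disjoint_left]
    rintro ⟨v, w⟩ ⟨h, -⟩ ⟨h', -⟩
    exact h' h
  · rintro ⟨v, w⟩ ⟨v', w'⟩ h
    obtain ⟨rfl, rfl⟩ := List.cons.inj h
    rfl
  · intro p
    simp [wordDegree]

/-- The numerator polynomial attached to the column degrees `l` of a pattern and to `n` columns. -/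
noncomputable def avoidingNumerator : List ℕ → ℕ → Polynomial ℤ
  | [], _ => 0
  | _ :: l, 0 => (1 - Polynomial.X) ^ l.length
  | b :: l, n + 1 => Polynomial.X ^ b * avoidingNumerator l n +
      (∑ i ∈ Finset.range b, Polynomial.X ^ i) * avoidingNumerator (b :: l) n

lemma weightSeries_avoidingWords {c : ℕ} (L : List (Fin c → ℕ)) (n : ℕ) :
    (1 - PowerSeries.X) ^ (c * n + L.length) * weightSeries wordDegree (avoidingWords L n) =
      (1 - PowerSeries.X) ^ (n + 1) *
        (avoidingNumerator (L.map fun v => ∑ i, v i) n : PowerSeries ℤ) := by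
  induction n generalizing L with
  | zero =>
    cases L with
    | nil =>
      simp [avoidingWords_nil, weightSeries_empty, avoidingNumerator]
    | cons A L =>
      have h : weightSeries wordDegree (avoidingWords (A :: L) 0) = 1 := by
        rw [avoidingWords_cons_zero]
        ext d
        simp only [weightSeries, PowerSeries.coeff_mk, PowerSeries.coeff_one]
        split_ifs with h
        · subst h
          have : {x ∈ ({[]} : Set (List (Fin c → ℕ))) | wordDegree x = 0} = {[]} := by
            ext w
            simp only [Set.mem_ofPred_eq, Set.mem_singleton_iff, and_iff_left_iff_imp]
            rintro rfl
            rfl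
          rw [this, Set.ncard_singleton, Nat.cast_one]
        · rw [Nat.cast_eq_zero]
          convert Set.ncard_empty (List (Fin c → ℕ))
          ext w
          simp only [Set.mem_ofPred_eq, Set.mem_singleton_iff, Set.mem_empty_iff_false, iff_false]
          rintro ⟨rfl, h'⟩
          exact h h'.symm
      rw [h]
      simp [avoidingNumerator, pow_succ, mul_comm]
  | succ n ih =>
    cases L with
    | nil =>
      simp [avoidingWords_nil, weightSeries_empty, avoidingNumerator]
    | cons A L =>
      have h₁ := ih L
      have h₂ := ih (A :: L)
      have h₃ := weightSeries_avoidingWords_cons_succ A L n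
      have hg := mul_neg_geom_sum (PowerSeries.X : PowerSeries ℤ) (∑ i, A i)
      simp only [List.map_cons, avoidingNumerator, List.length_cons, Polynomial.coe_add,
        Polynomial.coe_mul, Polynomial.coe_pow, Polynomial.coe_X] at h₂ ⊢
      have hs : ((∑ i ∈ Finset.range (∑ i, A i), Polynomial.X ^ i : Polynomial ℤ) :
          PowerSeries ℤ) = ∑ i ∈ Finset.range (∑ i, A i), PowerSeries.X ^ i := by
        rw [← Polynomial.coeToPowerSeries.ringHom_apply, map_sum]
        simp
      rw [hs]
      generalize (∑ i ∈ Finset.range (∑ i, A i), PowerSeries.X ^ i : PowerSeries ℤ) = g at *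
      linear_combination (1 - PowerSeries.X) ^ (c * n + L.length + 1) * h₃ +
        PowerSeries.X ^ (∑ i, A i) * (1 - PowerSeries.X) * h₁ + (1 - PowerSeries.X) * g * h₂ -
        (1 - PowerSeries.X) ^ (c * n + L.length + 1) *
          weightSeries wordDegree (avoidingWords (A :: L) n) * hg

lemma eval_avoidingNumerator_cons_zero (b : ℕ) (l : List ℕ) :
    (avoidingNumerator (b :: l) 0).eval 1 = if l.length = 0 then 1 else 0 := by
  simp [avoidingNumerator, zero_pow_eq]

lemma eval_avoidingNumerator_cons_succ (b : ℕ) (l : List ℕ) (n : ℕ) :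
    (avoidingNumerator (b :: l) (n + 1)).eval 1 =
      (avoidingNumerator l n).eval 1 + b * (avoidingNumerator (b :: l) n).eval 1 := by
  simp [avoidingNumerator, Polynomial.eval_finsetSum]

/-- The sum `∑ x ^ k / ∏ (x - y)` over `x ∈ T`, the product being over the other `y ∈ T`. -/
def nodeSum (T : Finset ℕ) (k : ℕ) : ℚ :=
  ∑ x ∈ T, (x : ℚ) ^ k / ∏ y ∈ T.erase x, ((x : ℚ) - y)

lemma nodeSum_insert_succ {T : Finset ℕ} {b : ℕ} (hb : b ∉ T) (k : ℕ) :
    nodeSum (insert b T) (k + 1) = nodeSum T k + b * nodeSum (insert b T) k := by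
  simp only [nodeSum, Finset.sum_insert hb, mul_add, Finset.mul_sum]
  have h : ∀ x ∈ T, (x : ℚ) ^ (k + 1) / ∏ y ∈ (insert b T).erase x, ((x : ℚ) - y) =
      (x : ℚ) ^ k / ∏ y ∈ T.erase x, ((x : ℚ) - y) +
        b * ((x : ℚ) ^ k / ∏ y ∈ (insert b T).erase x, ((x : ℚ) - y)) := by
    intro x hx
    have hxb : b ≠ x := fun h => hb (h ▸ hx)
    have hne : (x : ℚ) - b ≠ 0 := sub_ne_zero.2 (by exact_mod_cast hxb.symm)
    have hprod : ∏ y ∈ T.erase x, ((x : ℚ) - y) ≠ 0 :=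
      Finset.prod_ne_zero_iff.2 fun y hy =>
        sub_ne_zero.2 (by exact_mod_cast (Finset.ne_of_mem_erase hy).symm)
    rw [Finset.erase_insert_of_ne hxb, Finset.prod_insert fun h => hb (Finset.mem_of_mem_erase h)]
    field_simp
    ring
  rw [Finset.sum_congr rfl h, Finset.sum_add_distrib]
  ring

lemma nodeSum_card_sub_one {T : Finset ℕ} (hT : T.Nonempty) : nodeSum T (T.card - 1) = 1 := by
  have h := Lagrange.coeff_eq_sum (s := T) (v := fun x : ℕ => (x : ℚ))
    (Nat.cast_injective.injOn) (P := Polynomial.X ^ (T.card - 1)) (by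
      have := hT.card_pos
      rw [Polynomial.degree_X_pow]
      exact_mod_cast Nat.sub_lt this one_pos)
  simpa [nodeSum] using h.symm

lemma eval_avoidingNumerator (l : List ℕ) (n : ℕ) (hl : (l.filter (· ≠ 0)).Nodup) :
    (((avoidingNumerator l n).eval 1 : ℤ) : ℚ) =
      if l.length < n + 1 then
        nodeSum (l.filter (· ≠ 0)).toFinset (n + (l.filter (· ≠ 0)).toFinset.card - l.length)
      else if l.length = n + 1 then 1 else 0 := by
  induction n generalizing l with
  | zero =>
    cases l with
    | nil => simp [avoidingNumerator, nodeSum]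
    | cons b l =>
      rw [eval_avoidingNumerator_cons_zero]
      simp
  | succ n ih =>
    cases l with
    | nil => simp [avoidingNumerator, nodeSum]
    | cons b l =>
      rw [eval_avoidingNumerator_cons_succ]
      push_cast
      rcases eq_or_ne b 0 with rfl | hb
      · have hf : (0 :: l).filter (· ≠ 0) = l.filter (· ≠ 0) := by simp
        rw [hf] at hl ⊢
        rw [ih l hl]
        simp only [List.length_cons, Nat.cast_zero, zero_mul, add_zero,
          add_lt_add_iff_right, add_left_inj]
        congr 2
        omega
      · have hf : (b :: l).filter (· ≠ 0) = b :: l.filter (· ≠ 0) := by simp [hb]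
        have h₂ := ih (b :: l) hl
        rw [hf] at hl h₂ ⊢
        obtain ⟨hbl, hl'⟩ := List.nodup_cons.1 hl
        rw [ih l hl', h₂]
        rw [List.toFinset_cons]
        have hbT : b ∉ (l.filter (· ≠ 0)).toFinset := by rwa [List.mem_toFinset]
        have hle : (l.filter (· ≠ 0)).toFinset.card ≤ l.length :=
          (List.toFinset_card_le _).trans (List.length_filter_le _ _)
        generalize (l.filter (· ≠ 0)).toFinset = T at *
        rw [Finset.card_insert_of_notMem hbT, List.length_cons]
        rcases lt_trichotomy l.length (n + 1) with h | h | h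
        · rw [if_pos h, if_pos (show l.length + 1 < n + 1 + 1 by omega), show n + 1 + (T.card + 1) - (l.length + 1) =
            (n + T.card - l.length) + 1 by omega, nodeSum_insert_succ hbT]
          by_cases h' : l.length + 1 < n + 1
          · rw [if_pos h']
            congr 3
            omega
          · have hn : n = l.length := by omega
            rw [if_neg h', if_pos (show l.length + 1 = n + 1 by omega)]
            have h1 := nodeSum_card_sub_one (Finset.insert_nonempty b T)
            rw [Finset.card_insert_of_notMem hbT] at h1
            rw [← h1]
            congr 3
            omega
        · simp [h]
        · simp [h.not_gt, h.ne', show ¬ l.length + 1 < n + 1 by omega,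
            show l.length ≠ n by omega, show ¬ l.length ≤ n by omega]

lemma List.sublistForall₂_ofFn_iff {α β : Type*} {R : α → β → Prop} {s n : ℕ} {u : Fin s → α}
    {w : Fin n → β} :
    SublistForall₂ R (ofFn u) (ofFn w) ↔
      ∃ f : Fin s → Fin n, StrictMono f ∧ ∀ k, R (u k) (w (f k)) := by
  rw [sublistForall₂_iff]
  constructor
  · rintro ⟨l, hl, hsub⟩
    obtain ⟨f, hf⟩ := sublist_iff_exists_fin_orderEmbedding_get_eq.1 hsub
    obtain ⟨hlen, hget⟩ := forall₂_iff_get.1 hl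
    have hs : s = l.length := by simpa using hlen
    refine ⟨fun k => Fin.cast (by simp) (f (Fin.cast hs k)), fun k k' h => ?_, fun k => ?_⟩
    · exact f.strictMono (show Fin.cast hs k < Fin.cast hs k' from h)
    · have h1 := hget k (by simp) (hs ▸ k.2)
      have h2 := hf (Fin.cast hs k)
      simp only [List.get_eq_getElem, List.getElem_ofFn, Fin.val_cast] at h1 h2
      rw [h2] at h1
      exact h1
  · rintro ⟨f, hf, hR⟩
    refine ⟨ofFn (w ∘ f), forall₂_iff_get.2 ⟨by simp, fun k h _ => ?_⟩,
      sublist_iff_exists_fin_orderEmbedding_get_eq.2 ⟨OrderEmbedding.ofStrictMono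
        (fun k => Fin.cast (by simp) (f (Fin.cast (by simp) k))) fun k k' h => ?_, fun k => ?_⟩⟩
    · simpa using hR ⟨k, by simpa using h⟩
    · exact hf (show Fin.cast (by simp) k < Fin.cast (by simp) k' from h)
    · simp [Fin.cast]

lemma hilbF_eq_ncard (K : Type*) [Field K] {σ : Type*} [Finite σ] {I : Ideal (MvPolynomial σ K)}
    {M : Set (σ →₀ ℕ)} (hI : ∀ f, f ∈ I ↔ ∀ e ∈ f.support, e ∈ M) (j : ℕ) :
    hilbF K I j = {e ∈ Mᶜ | e.degree = j}.ncard := by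
  classical
  have := Fintype.ofFinite σ
  set S : Set (σ →₀ ℕ) := {e ∈ Mᶜ | e.degree = j}
  have hfin : S.Finite := (Finsupp.finite_of_degree_le (σ := σ) j).subset fun e he => he.2.le
  have := hfin.fintype
  let φ : homogeneousSubmodule σ K j →ₗ[K] (S → K) :=
    LinearMap.pi fun s => (lcoeff K s.1) ∘ₗ (homogeneousSubmodule σ K j).subtype
  have hφ : ∀ f s, φ f s = coeff s.1 f.1 := fun _ _ => rfl
  have hker : Submodule.comap (homogeneousSubmodule σ K j).subtype
      (Submodule.restrictScalars K I) = LinearMap.ker φ := by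
    ext f
    rw [Submodule.mem_comap, Submodule.restrictScalars_mem, hI, LinearMap.mem_ker]
    constructor
    · intro h
      ext s
      rw [hφ, Pi.zero_apply]
      by_contra hne
      exact s.2.1 (h s.1 (mem_support_iff.2 hne))
    · intro h e he
      by_contra hM
      have hdeg : e.degree = j := by
        have := (mem_homogeneousSubmodule j _).1 f.2 (mem_support_iff.1 he)
        rwa [Finsupp.degree_eq_weight_one]
      exact mem_support_iff.1 he ((hφ f ⟨e, hM, hdeg⟩).symm.trans (congrFun h _))
  have hsurj : Function.Surjective φ := by
    intro g
    refine ⟨⟨∑ s : S, monomial s.1 (g s), Submodule.sum_mem _ fun s _ =>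
      (mem_homogeneousSubmodule j _).2 (isHomogeneous_monomial _ s.2.2)⟩, ?_⟩
    ext s
    rw [hφ, coeff_sum]
    simp [coeff_monomial, Subtype.val_inj]
  rw [hilbF, hker, (LinearMap.quotKerEquivOfSurjective φ hsurj).finrank_eq,
    Module.finrank_fintype_fun_eq_card, ← Nat.card_eq_fintype_card, Nat.card_coe_set_eq]

lemma hseries_eq_weightSeries (K : Type*) [Field K] {σ : Type*} [Finite σ]
    {I : Ideal (MvPolynomial σ K)} {M : Set (σ →₀ ℕ)}
    (hI : ∀ f, f ∈ I ↔ ∀ e ∈ f.support, e ∈ M) :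
    hseries K I = weightSeries Finsupp.degree Mᶜ := by
  ext j
  simp only [hseries, weightSeries, PowerSeries.coeff_mk]
  rw [hilbF_eq_ncard K hI]

lemma orbMonC_eq_monomial (K : Type*) [Field K] (c r : ℕ) (μ : ℕ → ℕ) (a : Fin c → ℕ → ℕ) :
    ∃ e : Fin c × ℕ →₀ ℕ, orbMonC K c r μ a = monomial e 1 ∧
      ∀ i j, e (i, j) = if j ∈ Finset.Icc 1 (μ (r - 1)) then a i j else 0 := by
  refine ⟨∑ i : Fin c, ∑ j ∈ Finset.Icc 1 (μ (r - 1)), Finsupp.single (i, j) (a i j), ?_, ?_⟩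
  · simp only [orbMonC, X_pow_eq_monomial, monomial_sum_one]
  · intro i j
    simp [Finsupp.finsetSum_apply, Finsupp.single_apply, ite_and]

/-- The list of columns of an exponent vector on `n` columns. -/
def columnWord {c n : ℕ} (e : Fin c × ColIdx n →₀ ℕ) : List (Fin c → ℕ) :=
  List.ofFn fun k : Fin n => fun i => e (i, ⟨k + 1, Finset.mem_Icc.2 ⟨by omega, by omega⟩⟩)

/-- The list of the first `s` columns of a matrix, starting from column `1`. -/
def columnPattern {c : ℕ} (a : Fin c → ℕ → ℕ) (s : ℕ) : List (Fin c → ℕ) :=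
  List.ofFn fun k : Fin s => fun i => a i (k + 1)

lemma Finsupp.mapDomain_le_iff {α β : Type*} {f : α → β} (hf : Function.Injective f)
    {e : α →₀ ℕ} {E : β →₀ ℕ} : Finsupp.mapDomain f e ≤ E ↔ ∀ x, e x ≤ E (f x) := by
  constructor
  · intro h x
    simpa [Finsupp.mapDomain_apply hf] using h (f x)
  · intro h y
    by_cases hy : y ∈ Set.range f
    · obtain ⟨x, rfl⟩ := hy
      rw [Finsupp.mapDomain_apply hf]
      exact h x
    · rw [Finsupp.mapDomain_of_notMem_range _ _ hy]
      exact Nat.zero_le _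

lemma exists_strictMono_le_iff {c s n : ℕ} {a : Fin c → ℕ → ℕ} (hs : 1 ≤ s)
    (has : ∃ i, a i s ≠ 0) {E : Fin c × ℕ → ℕ} (hE : ∀ i j, n < j → E (i, j) = 0) :
    (∃ π : ℕ → ℕ, StrictMono π ∧ ∀ i, ∀ j ∈ Finset.Icc 1 s, a i j ≤ E (i, π j)) ↔
      List.SublistForall₂ (· ≤ ·) (columnPattern a s)
        (List.ofFn fun k : Fin n => fun i => E (i, k + 1)) := by
  rw [columnPattern, List.sublistForall₂_ofFn_iff]
  constructor
  · rintro ⟨π, hπ, h⟩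
    obtain ⟨i₀, hi₀⟩ := has
    have hn : π s ≤ n := by
      by_contra hlt
      have := h i₀ s (Finset.mem_Icc.2 ⟨hs, le_rfl⟩)
      rw [hE _ _ (not_le.1 hlt)] at this
      omega
    have hle : ∀ k : Fin s, π (k + 1) ≤ n := fun k =>
      (hπ.monotone (by omega)).trans hn
    have hpos : ∀ k : Fin s, 1 ≤ π (k + 1) := fun k => by
      have := hπ.le_apply (x := (k : ℕ) + 1)
      omega
    refine ⟨fun k => ⟨π (k + 1) - 1, by have := hle k; have := hpos k; omega⟩,
      fun k k' hk => ?_, fun k i => ?_⟩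
    · have h1 := hπ (show (k : ℕ) + 1 < k' + 1 by simpa using hk)
      have := hpos k
      rw [Fin.mk_lt_mk]
      omega
    · have := h i (k + 1) (Finset.mem_Icc.2 ⟨by omega, by omega⟩)
      rwa [← Nat.sub_add_cancel (hpos k)] at this
  · rintro ⟨f, hf, h⟩
    refine ⟨fun j => if hj : j - 1 < s then (if j = 0 then 0 else f ⟨j - 1, hj⟩ + 1)
      else n + j, ?_, ?_⟩
    · intro j j' hjj
      have hj' : j' ≠ 0 := by omega
      dsimp only
      by_cases h' : j' - 1 < s
      · have h0 : j - 1 < s := by omega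
        rw [dif_pos h0, dif_pos h', if_neg hj']
        split_ifs with hj
        · omega
        · have := hf (show (⟨j - 1, h0⟩ : Fin s) < ⟨j' - 1, h'⟩ from
            Fin.mk_lt_mk.2 (by omega))
          have := Fin.lt_def.1 this
          omega
      · rw [dif_neg h']
        split_ifs with h0 hj
        · omega
        · have := (f ⟨j - 1, h0⟩).2
          omega
        · omega
    · intro i j hj
      obtain ⟨h1, h2⟩ := Finset.mem_Icc.1 hj
      have h0 : j - 1 < s := by omega
      dsimp only
      rw [dif_pos h0, if_neg (by omega)]
      simpa [Nat.sub_add_cancel h1] using h ⟨j - 1, h0⟩ i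

lemma toBigC_index_injective (c n : ℕ) :
    Function.Injective fun p : Fin c × ColIdx n => ((p.1, p.2.1) : Fin c × ℕ) := by
  rintro ⟨i, j⟩ ⟨i', j'⟩ h
  simp only [Prod.mk.injEq] at h
  exact Prod.ext h.1 (Subtype.ext h.2)

lemma mem_restrC_orbitIdealC_iff (K : Type*) [Field K] {c r : ℕ} {μ : ℕ → ℕ}
    {a : Fin c → ℕ → ℕ} (hs : 1 ≤ μ (r - 1)) (has : ∃ i, a i (μ (r - 1)) ≠ 0) (n : ℕ)
    (f : MvPolynomial (Fin c × ColIdx n) K) :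
    f ∈ restrC K (orbitIdealC K (orbMonC K c r μ a)) n ↔
      ∀ e ∈ f.support, e ∈ {e | List.SublistForall₂ (· ≤ ·)
        (columnPattern a (μ (r - 1))) (columnWord e)} := by
  classical
  obtain ⟨e₀, he₀, happ⟩ := orbMonC_eq_monomial K c r μ a
  have hinj : ∀ {π : ℕ → ℕ}, StrictMono π →
      Function.Injective fun p : Fin c × ℕ => (p.1, π p.2) := by
    rintro π hπ ⟨i, j⟩ ⟨i', j'⟩ h
    simp only [Prod.mk.injEq] at h
    exact Prod.ext h.1 (hπ.injective h.2)
  have hspan : orbitIdealC K (orbMonC K c r μ a) = Ideal.span ((fun e => monomial e (1 : K)) ''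
      {e | ∃ π : ℕ → ℕ, StrictMono π ∧ e = Finsupp.mapDomain (fun p => (p.1, π p.2)) e₀}) := by
    rw [orbitIdealC, he₀]
    congr 1
    ext q
    constructor
    · rintro ⟨π, hπ, rfl⟩
      exact ⟨_, ⟨π, hπ, rfl⟩, (rename_monomial _ _ _).symm⟩
    · rintro ⟨_, ⟨π, hπ, rfl⟩, rfl⟩
      exact ⟨π, hπ, (rename_monomial _ _ _).symm⟩
  rw [restrC, Ideal.mem_comap, hspan, mem_ideal_span_monomial_image, toBigC,
    support_rename_of_injective (toBigC_index_injective c n), Finset.forall_mem_image]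
  refine forall₂_congr fun e _ => ?_
  have hword : columnWord e = List.ofFn fun k : Fin n => fun i =>
      Finsupp.mapDomain (fun p : Fin c × ColIdx n => ((p.1, p.2.1) : Fin c × ℕ)) e
        (i, k + 1) := by
    rw [columnWord]
    congr 1
    ext k i
    exact (Finsupp.mapDomain_apply (toBigC_index_injective c n) e
      (i, ⟨k + 1, Finset.mem_Icc.2 ⟨by omega, by omega⟩⟩)).symm
  rw [Set.mem_ofPred_eq, hword, ← exists_strictMono_le_iff hs has]
  · constructor
    · rintro ⟨_, ⟨π, hπ, rfl⟩, hle⟩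
      refine ⟨π, hπ, fun i j hj => ?_⟩
      simpa [happ, Finset.mem_Icc.1 hj] using (Finsupp.mapDomain_le_iff (hinj hπ)).1 hle (i, j)
    · rintro ⟨π, hπ, h⟩
      refine ⟨_, ⟨π, hπ, rfl⟩, (Finsupp.mapDomain_le_iff (hinj hπ)).2 ?_⟩
      rintro ⟨i, j⟩
      rw [happ]
      split_ifs with hj
      · exact h i j hj
      · exact Nat.zero_le _
  · intro i j hj
    refine Finsupp.mapDomain_of_notMem_range _ _ ?_
    rintro ⟨⟨i', j'⟩, h⟩
    simp only [Prod.mk.injEq] at h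
    have := (Finset.mem_Icc.1 j'.2).2
    omega

lemma image_columnWord {c s n : ℕ} (a : Fin c → ℕ → ℕ) :
    columnWord '' {e : Fin c × ColIdx n →₀ ℕ | List.SublistForall₂ (· ≤ ·)
      (columnPattern a s) (columnWord e)}ᶜ = avoidingWords (columnPattern a s) n := by
  ext w
  constructor
  · rintro ⟨e, he, rfl⟩
    exact ⟨by simp [columnWord], he⟩
  · rintro ⟨rfl, hw⟩
    have h : columnWord (Finsupp.equivFunOnFinite.symm
        fun p : Fin c × ColIdx w.length => w.get ⟨p.2.1 - 1, by
          have := Finset.mem_Icc.1 p.2.2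
          omega⟩ p.1) = w := by
      simp [columnWord]
    exact ⟨_, by rwa [Set.mem_compl_iff, Set.mem_ofPred_eq, h], h⟩

lemma columnWord_injective (c n : ℕ) :
    Function.Injective (columnWord : (Fin c × ColIdx n →₀ ℕ) → _) := by
  intro e e' h
  ext ⟨i, j, hj⟩
  obtain ⟨h1, h2⟩ := Finset.mem_Icc.1 hj
  have := congrFun (congrFun (List.ofFn_injective h) ⟨j - 1, by omega⟩) i
  simpa [Nat.sub_add_cancel h1] using this

lemma wordDegree_columnWord {c n : ℕ} (e : Fin c × ColIdx n →₀ ℕ) :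
    wordDegree (columnWord e) = e.degree := by
  rw [wordDegree, columnWord, List.map_ofFn, List.sum_ofFn, Finsupp.degree_eq_sum,
    Fintype.sum_prod_type_right]
  refine Fintype.sum_bijective
    (fun k : Fin n => (⟨k + 1, Finset.mem_Icc.2 ⟨by omega, by omega⟩⟩ : ColIdx n))
    ⟨fun k k' h => ?_, fun ⟨j, hj⟩ => ?_⟩ _ _ fun k => rfl
  · simpa [Fin.ext_iff] using h
  · obtain ⟨h1, h2⟩ := Finset.mem_Icc.1 hj
    exact ⟨⟨j - 1, by omega⟩, Subtype.ext (Nat.sub_add_cancel h1)⟩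

lemma hseries_restrC_orbitIdealC (K : Type*) [Field K] {c r : ℕ} {μ : ℕ → ℕ}
    {a : Fin c → ℕ → ℕ} (hs : 1 ≤ μ (r - 1)) (has : ∃ i, a i (μ (r - 1)) ≠ 0) (n : ℕ) :
    hseries K (restrC K (orbitIdealC K (orbMonC K c r μ a)) n) =
      weightSeries wordDegree (avoidingWords (columnPattern a (μ (r - 1))) n) := by
  rw [hseries_eq_weightSeries K (mem_restrC_orbitIdealC_iff K hs has n), ← image_columnWord,
    weightSeries_image (columnWord_injective c n) wordDegree_columnWord]

lemma columnPattern_filter {c r : ℕ} (hr : 1 ≤ r) {μ : ℕ → ℕ} (hμ1 : 1 ≤ μ 0)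
    (hμ : ∀ j, j + 1 < r → μ j < μ (j + 1)) {a : Fin c → ℕ → ℕ}
    (hcols : ∀ j : ℕ, (∃ i, a i j ≠ 0) ↔ ∃ k, k < r ∧ j = μ k)
    {b : ℕ → ℕ} (hb : ∀ j, b j = ∑ i : Fin c, a i (μ j))
    (hdist : ∀ i j, i < r → j < r → i ≠ j → b i ≠ b j) :
    (((columnPattern a (μ (r - 1))).map fun v => ∑ i, v i).filter (· ≠ 0)).Nodup ∧
      (((columnPattern a (μ (r - 1))).map fun v => ∑ i, v i).filter (· ≠ 0)).toFinset =
        (Finset.range r).image b := by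
  have hmono : ∀ k l, k ≤ l → l < r → μ k ≤ μ l := by
    intro k l hkl
    induction l, hkl using Nat.le_induction with
    | base => exact fun _ => le_rfl
    | succ l _ ih => exact fun hl => (ih (by omega)).trans (hμ l hl).le
  have hcol : ∀ j, ∑ i, a i j ≠ 0 → ∃ k, k < r ∧ j = μ k := by
    intro j hj
    obtain ⟨i, -, hi⟩ := Finset.exists_ne_zero_of_sum_ne_zero hj
    exact (hcols j).1 ⟨i, hi⟩
  have hb0 : ∀ k, k < r → b k ≠ 0 := by
    intro k hk h
    obtain ⟨i, hi⟩ := (hcols (μ k)).2 ⟨k, hk, rfl⟩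
    rw [hb, Finset.sum_eq_zero_iff] at h
    exact hi (h i (Finset.mem_univ i))
  have hmap : (columnPattern a (μ (r - 1))).map (fun v => ∑ i, v i) =
      (List.finRange (μ (r - 1))).map fun k : Fin _ => ∑ i, a i (k + 1) := by
    rw [columnPattern, List.map_ofFn, List.ofFn_eq_map]
    rfl
  rw [hmap, List.filter_map]
  constructor
  · refine List.Nodup.map_on ?_ ((List.nodup_finRange _).filter _)
    intro x hx y hy hxy
    simp only [List.mem_filter, List.mem_finRange, true_and, Function.comp_apply,
      decide_eq_true_eq] at hx hy
    obtain ⟨k, hk, hxk⟩ := hcol _ hx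
    obtain ⟨l, hl, hyl⟩ := hcol _ hy
    rw [hxk, hyl, ← hb, ← hb] at hxy
    have hkl : k = l := by
      by_contra hne
      exact hdist k l hk hl hne hxy
    subst hkl
    exact Fin.ext (by omega)
  · ext x
    simp only [List.mem_toFinset, List.mem_map, List.mem_filter, List.mem_finRange, true_and,
      Function.comp_apply, decide_eq_true_eq, Finset.mem_image, Finset.mem_range]
    constructor
    · rintro ⟨k, hk, rfl⟩
      obtain ⟨l, hl, hkl⟩ := hcol _ hk
      exact ⟨l, hl, by rw [hb, hkl]⟩
    · rintro ⟨l, hl, rfl⟩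
      have h1 : 1 ≤ μ l := hμ1.trans (hmono 0 l (Nat.zero_le _) hl)
      have h2 : μ l ≤ μ (r - 1) := hmono l (r - 1) (by omega) (by omega)
      have h3 : ∑ i, a i (μ l - 1 + 1) = b l := by rw [Nat.sub_add_cancel h1, hb]
      exact ⟨⟨μ l - 1, by omega⟩, by rw [h3]; exact hb0 l hl, h3⟩

lemma nodeSum_image_range {r : ℕ} {b : ℕ → ℕ}
    (hb : Set.InjOn b (Finset.range r)) (k : ℕ) :
    nodeSum ((Finset.range r).image b) k = ∑ i ∈ Finset.range r,
      (b i : ℚ) ^ k / ∏ j ∈ (Finset.range r).erase i, ((b i : ℚ) - (b j : ℚ)) := by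
  rw [nodeSum, Finset.sum_image hb]
  refine Finset.sum_congr rfl fun i hi => ?_
  congr 1
  have h : ((Finset.range r).image b).erase (b i) = ((Finset.range r).erase i).image b := by
    ext x
    simp only [Finset.mem_erase, Finset.mem_image]
    constructor
    · rintro ⟨hne, j, hj, rfl⟩
      exact ⟨j, ⟨fun h => hne (h ▸ rfl), hj⟩, rfl⟩
    · rintro ⟨j, ⟨hne, hj⟩, rfl⟩
      exact ⟨fun h => hne (hb hj hi h), j, hj, rfl⟩
  rw [h, Finset.prod_image fun x hx y hy => hb (Finset.mem_of_mem_erase hx)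
    (Finset.mem_of_mem_erase hy)]

/-- With `b_j = Σᵢ a_{i,μ_j}` pairwise distinct and `n ≥ μ_r - 1`, in `ℚ`:
`deg I_n = Σᵢ bᵢ^{n-μ_r+r} / ∏_{j≠i} (bᵢ - bⱼ)`, where `deg I_n` is the value at `t = 1` of
the polynomial `(1-t)^{n(c-1)+μ_r-1}·H_{K[X_n]/I_n}(t)`. -/
theorem statement17 (K : Type*) [Field K] (c : ℕ) (hc : 1 ≤ c) (r : ℕ) (hr : 1 ≤ r)
    (μ : ℕ → ℕ) (hμ1 : 1 ≤ μ 0) (hμ : ∀ j, j + 1 < r → μ j < μ (j + 1))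
    (a : Fin c → ℕ → ℕ) (hcols : ∀ j : ℕ, (∃ i, a i j ≠ 0) ↔ ∃ k, k < r ∧ j = μ k)
    (b : ℕ → ℕ) (hb : ∀ j, b j = ∑ i : Fin c, a i (μ j))
    (hdist : ∀ i j, i < r → j < r → i ≠ j → b i ≠ b j)
    (n : ℕ) (hn : μ (r - 1) ≤ n + 1)
    (p : Polynomial ℤ)
    (hp : (↑p : PowerSeries ℤ) =
      (1 - PowerSeries.X : PowerSeries ℤ) ^ (n * (c - 1) + μ (r - 1) - 1) *
        hseries K (restrC K (orbitIdealC K (orbMonC K c r μ a)) n)) :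
    ((p.eval 1 : ℤ) : ℚ) =
      ∑ i ∈ Finset.range r,
        (b i : ℚ) ^ (n + r - μ (r - 1)) /
          ∏ j ∈ (Finset.range r).erase i, ((b i : ℚ) - (b j : ℚ)) := by
  have hs : 1 ≤ μ (r - 1) := by
    have h : ∀ k, k < r → 1 ≤ μ k := by
      intro k
      induction k with
      | zero => exact fun _ => hμ1
      | succ k ih => exact fun hk => (ih (by omega)).trans (hμ k hk).le
    exact h _ (by omega)
  have hser := weightSeries_avoidingWords (columnPattern a (μ (r - 1))) n
  rw [← hseries_restrC_orbitIdealC K hs ((hcols _).2 ⟨r - 1, by omega, rfl⟩) n] at hser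
  obtain ⟨hnodup, hfin⟩ := columnPattern_filter hr hμ1 hμ hcols hb hdist
  have hlen : (columnPattern a (μ (r - 1))).length = μ (r - 1) := by simp [columnPattern]
  have hX : (1 - PowerSeries.X : PowerSeries ℤ) ≠ 0 := fun h => by
    simpa using congrArg PowerSeries.constantCoeff h
  have hexp : c * n + μ (r - 1) = n + 1 + (n * (c - 1) + μ (r - 1) - 1) := by
    obtain ⟨d, rfl⟩ := Nat.exists_eq_add_of_le' hc
    obtain ⟨m, hm⟩ := Nat.exists_eq_add_of_le' hs
    rw [hm, Nat.add_sub_cancel, ← Nat.add_assoc (n * d), Nat.add_sub_cancel]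
    ring
  rw [hlen, hexp, pow_add, mul_assoc, ← hp] at hser
  have hpoly := Polynomial.coe_injective ℤ (mul_left_cancel₀ (pow_ne_zero _ hX) hser)
  have hinj : Set.InjOn b (Finset.range r) := fun i hi j hj h => by
    by_contra hne
    exact hdist i j (Finset.mem_range.1 hi) (Finset.mem_range.1 hj) hne h
  rw [hpoly, eval_avoidingNumerator _ _ hnodup, hfin, List.length_map, hlen,
    Finset.card_image_of_injOn hinj, Finset.card_range]
  rcases hn.lt_or_eq with h | h
  · rw [if_pos h, nodeSum_image_range hinj]
  · rw [if_neg (by omega), if_pos h, ← nodeSum_image_range hinj,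
      show n + r - μ (r - 1) = ((Finset.range r).image b).card - 1 by
        rw [Finset.card_image_of_injOn hinj, Finset.card_range]; omega,
      nodeSum_card_sub_one ((Finset.nonempty_range_iff.2 (by omega)).image b)]
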